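/- Let R be a commutative integral domain, G a group acting faithfully on R by ring automorphisms (for every g ≠ 1 there exists y ∈ R with g(y) ≠ y), and A = R#G the skew group ring. Let d : A → A be a derivation. Then for every ψ ∈ R fixed by every element of G, d(ψ·δ_1) lies in R·δ_1, i.e., the coefficient of δ_g in d(ψ·δ_1) is zero for every g ≠ 1. -/

import Mathlib

/-- The skew group ring `A = R#G`: its underlying additive group is the finitely
supported functions `G →₀ R` (so `r·δ_g` is `Finsupp.single g r`), with the
multiplication determined by `(r·δ_g)(s·δ_h) = (r · g(s))·δ_{g h}`, where the
action of `G` on `R` by ring automorphisms is given by `ρ : G →* (R ≃+* R)`. -/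
noncomputable def skewMul {R G : Type*} [CommRing R] [Group G]
    (ρ : G →* (R ≃+* R)) (f₁ f₂ : G →₀ R) : G →₀ R :=
  f₁.sum fun a r => f₂.sum fun b s => Finsupp.single (a * b) (r * ρ a s)

/-- Right multiplication by `y·δ_1` scales the coefficient at `g` by `g y`. -/
lemma skewMul_single_one_right_apply {R G : Type*} [CommRing R] [Group G]
    (ρ : G →* (R ≃+* R)) (f : G →₀ R) (y : R) (g : G) :
    skewMul ρ f (Finsupp.single 1 y) g = f g * ρ g y := by
  classical
  have hinner (a : G) (r : R) :
      ((Finsupp.single (1 : G) y).sum fun b s => Finsupp.single (a * b) (r * ρ a s)) =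
        Finsupp.single a (r * ρ a y) := by
    rw [Finsupp.sum_single_index (by simp), mul_one]
  simp only [skewMul, hinner]
  simp +contextual [Finsupp.single_apply, Finsupp.sum]

/-- Left multiplication by `y·δ_1` scales every coefficient by `y`. -/
lemma skewMul_single_one_left_apply {R G : Type*} [CommRing R] [Group G]
    (ρ : G →* (R ≃+* R)) (f : G →₀ R) (y : R) (g : G) :
    skewMul ρ (Finsupp.single 1 y) f g = y * f g := by
  classical
  rw [skewMul, Finsupp.sum_single_index (by simp)]
  simp +contextual [Finsupp.single_apply, Finsupp.sum]

/-- An element of `R` fixed by `G` is central in the skew group ring. -/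
lemma skewMul_single_one_comm {R G : Type*} [CommRing R] [Group G]
    (ρ : G →* (R ≃+* R)) {ψ : R} (hψ : ∀ g : G, ρ g ψ = ψ) (f : G →₀ R) :
    skewMul ρ (Finsupp.single 1 ψ) f = skewMul ρ f (Finsupp.single 1 ψ) := by
  ext g
  rw [skewMul_single_one_left_apply, skewMul_single_one_right_apply, hψ, mul_comm]

/-- Let `R` be a commutative integral domain, `G` a group acting
faithfully on `R` by ring automorphisms (for every `g ≠ 1` there is `y ∈ R` with
`g y ≠ y`), and `A = R#G` the skew group ring. Let `d : A → A` be a derivation.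
Then for every `ψ ∈ R` fixed by every element of `G`, `d (ψ·δ_1)` lies in
`R·δ_1`; i.e. the coefficient of `δ_g` in `d (ψ·δ_1)` is zero for every `g ≠ 1`. -/
theorem stmt_2 {R G : Type*} [CommRing R] [IsDomain R] [Group G]
    (ρ : G →* (R ≃+* R))
    (hfaithful : ∀ g : G, g ≠ 1 → ∃ y : R, ρ g y ≠ y)
    (d : (G →₀ R) →+ (G →₀ R))
    (hd : ∀ a b : G →₀ R,
      d (skewMul ρ a b) = skewMul ρ (d a) b + skewMul ρ a (d b))
    (ψ : R) (hψ : ∀ g : G, ρ g ψ = ψ) :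
    ∀ g : G, g ≠ 1 → d (Finsupp.single (1 : G) ψ) g = 0 := by
  intro g hg
  obtain ⟨y, hy⟩ := hfaithful g hg
  have h := congrArg (fun f => d f g) (skewMul_single_one_comm ρ hψ (Finsupp.single 1 y))
  simp only [hd, Finsupp.add_apply, skewMul_single_one_left_apply,
    skewMul_single_one_right_apply, hψ] at h
  have hmul : d (Finsupp.single 1 ψ) g * (ρ g y - y) = 0 := by linear_combination h
  exact (mul_eq_zero.mp hmul).resolve_right (sub_ne_zero.mpr hy)
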